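/- Let k ≥ 3 and let π ∈ S_n be a 132-avoiding permutation not equal to the identity. Then π avoids the pattern 2 1 3 4 ⋯ k (the permutation of S_k sending 1↦2, 2↦1, and j↦j for j ≥ 3) if and only if every corner (i,j) of the diagram D(π) satisfies i + j ≥ n + 3 − k. -/

import Mathlib

def Contains {n k : ℕ} (π : Equiv.Perm (Fin n)) (τ : Equiv.Perm (Fin k)) : Prop :=
  ∃ f : Fin k → Fin n, (∀ a b : Fin k, a < b → f a < f b) ∧
    ∀ a b : Fin k, τ a < τ b ↔ π (f a) < π (f b)

instance {n k : ℕ} (π : Equiv.Perm (Fin n)) (τ : Equiv.Perm (Fin k)) : Decidable (Contains π τ) := by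
  unfold Contains; infer_instance

def Avoids {n k : ℕ} (π : Equiv.Perm (Fin n)) (τ : Equiv.Perm (Fin k)) : Prop := ¬ Contains π τ

instance {n k : ℕ} (π : Equiv.Perm (Fin n)) (τ : Equiv.Perm (Fin k)) : Decidable (Avoids π τ) := by
  unfold Avoids; infer_instance

/-- The pattern 132 as a permutation of `Fin 3` (0-indexed values 0,2,1). -/
def pat132 : Equiv.Perm (Fin 3) := Equiv.swap 1 2

/-- The pattern 321 as a permutation of `Fin 3`. -/
def pat321 : Equiv.Perm (Fin 3) := Fin.revPerm


/-- The diagram of a permutation: cells (i,j) (0-indexed) with j < π i and i < π⁻¹ j. -/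
def DiagramF {n : ℕ} (π : Equiv.Perm (Fin n)) : Finset (Fin n × Fin n) :=
  Finset.univ.filter (fun p => p.2 < π p.1 ∧ p.1 < π.symm p.2)

/-- The corners of the diagram: cells (i,j) in D(π) with (i+1,j) ∉ D(π) and
(i,j+1) ∉ D(π). -/
def DCorners {n : ℕ} (π : Equiv.Perm (Fin n)) : Finset (Fin n × Fin n) :=
  (DiagramF π).filter (fun p =>
    (∀ h : (p.1 : ℕ) + 1 < n, (⟨(p.1 : ℕ) + 1, h⟩, p.2) ∉ DiagramF π) ∧
    (∀ h : (p.2 : ℕ) + 1 < n, (p.1, ⟨(p.2 : ℕ) + 1, h⟩) ∉ DiagramF π))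

lemma av132 {n : ℕ} {π : Equiv.Perm (Fin n)} (hπ : Avoids π pat132) (a b c : Fin n)
    (h1 : a < b) (h2 : b < c) (h3 : π a < π c) (h4 : π c < π b) : False := by
  apply hπ
  refine ⟨![a, b, c], ?_, ?_⟩
  · intro x y hxy
    fin_cases x <;> fin_cases y <;> simp at hxy ⊢ <;> first | assumption | exact h1.trans h2
  · have e0 : pat132 0 = 0 := by decide
    have e1 : pat132 1 = 2 := by decide
    have e2 : pat132 2 = 1 := by decide
    have h5 := h3.trans h4
    intro x y
    fin_cases x <;> fin_cases y <;> simp [e0, e1, e2, h3, h4, h5, h3.le, h4.le, h5.le]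

lemma diag_rows {n : ℕ} {π : Equiv.Perm (Fin n)} (hπ : Avoids π pat132) {i j : Fin n}
    (h : (i, j) ∈ DiagramF π) (a : Fin n) (ha : a ≤ i) : j < π a := by
  simp only [DiagramF, Finset.mem_filter, Finset.mem_univ, true_and] at h
  obtain ⟨h1, h2⟩ := h
  by_contra hc
  push Not at hc
  have hne : π a ≠ j := by
    rintro rfl
    simp at h2
    omega
  have hlt : π a < j := lt_of_le_of_ne hc hne
  have hai : a < i := lt_of_le_of_ne ha (by rintro rfl; omega)
  exact av132 hπ a i (π.symm j) hai h2 (by simpa using hlt) (by simpa using h1)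

def Reg {n : ℕ} (π : Equiv.Perm (Fin n)) (i j : Fin n) : Finset (Fin n) :=
  Finset.univ.filter (fun a => i < a ∧ j < π a)

lemma reg_card {n : ℕ} {π : Equiv.Perm (Fin n)} (hπ : Avoids π pat132) {i j : Fin n}
    (h : (i, j) ∈ DiagramF π) : (Reg π i j).card + (i + 1) + (j + 1) = n := by
  have hr := diag_rows hπ h
  have e1 : (Finset.Iic i).card = (i : ℕ) + 1 := by simp
  have e2 : ((Finset.Iic j).map π.symm.toEmbedding).card = (j : ℕ) + 1 := by simp
  have d1 : Disjoint (Reg π i j) (Finset.Iic i) := by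
    rw [Finset.disjoint_left]
    intro a ha hb
    simp [Reg] at ha hb
    omega
  have d2 : Disjoint (Reg π i j ∪ Finset.Iic i) ((Finset.Iic j).map π.symm.toEmbedding) := by
    rw [Finset.disjoint_left]
    intro a ha hb
    simp [Reg] at ha hb
    rcases ha with ha | ha
    · omega
    · have := hr a ha
      omega
  have hu : (Reg π i j ∪ Finset.Iic i) ∪ ((Finset.Iic j).map π.symm.toEmbedding)
      = Finset.univ := by
    ext a
    simp [Reg]
    omega
  have := congrArg Finset.card hu
  rw [Finset.card_union_of_disjoint d2, Finset.card_union_of_disjoint d1, e1, e2] at this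
  simpa using this

lemma swap_val {m : ℕ} (a : Fin (m + 2)) :
    ((Equiv.swap (⟨0, by omega⟩ : Fin (m + 2)) ⟨1, by omega⟩ a : Fin (m + 2)) : ℕ) =
      if (a : ℕ) = 0 then (1 : ℕ) else if (a : ℕ) = 1 then (0 : ℕ) else (a : ℕ) := by
  rw [Equiv.swap_apply_def]
  simp only [Fin.ext_iff]
  split_ifs <;> rfl

theorem stmt12 (n k : ℕ) (hk : 3 ≤ k) (π : Equiv.Perm (Fin n))
    (hπ : Avoids π pat132) (hne : π ≠ 1) :
    Avoids π (Equiv.swap (⟨0, by omega⟩ : Fin k) ⟨1, by omega⟩) ↔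
      ∀ p ∈ DCorners π, n + 1 ≤ (p.1 : ℕ) + (p.2 : ℕ) + k := by
  obtain ⟨m, rfl⟩ : ∃ m, k = m + 2 := ⟨k - 2, by omega⟩
  constructor
  · rintro hav ⟨i, j⟩ hp
    by_contra hc
    simp only [DCorners, Finset.mem_filter] at hp
    obtain ⟨hD, hc1, hc2⟩ := hp
    have hcard := reg_card hπ hD
    have hr := diag_rows hπ hD
    have hD' := hD
    simp only [DiagramF, Finset.mem_filter, Finset.mem_univ, true_and] at hD' hc1 hc2
    obtain ⟨hD1, hD2⟩ := hD'
    simp only at hc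
    have hi : (i : ℕ) + 1 < n := by omega
    have hj : (j : ℕ) + 1 < n := by omega
    obtain ⟨i', hi'⟩ : ∃ i' : Fin n, i' = ⟨(i : ℕ) + 1, hi⟩ := ⟨_, rfl⟩
    obtain ⟨j', hj'⟩ : ∃ j' : Fin n, j' = ⟨(j : ℕ) + 1, hj⟩ := ⟨_, rfl⟩
    have hc1 := hc1 hi
    have hc2 := hc2 hj
    rw [← hi'] at hc1
    rw [← hj'] at hc2
    have hi'v : (i' : ℕ) = i + 1 := by rw [hi']
    have hj'v : (j' : ℕ) = j + 1 := by rw [hj']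
    have q1 : π i' ≤ j := by
      by_contra hh
      push Not at hh
      apply hc1
      refine ⟨hh, ?_⟩
      have : π.symm j ≠ i' := by
        intro h; rw [← h] at hh; simp at hh
      omega
    have q2 : π.symm j' ≤ i := by
      by_contra hh
      push Not at hh
      apply hc2
      refine ⟨?_, hh⟩
      have : π i ≠ j' := by
        intro h; rw [← h] at hh; simp at hh
      omega
    have hm : m ≤ (Reg π i j).card := by omega
    let g := (Reg π i j).orderEmbOfCardLe hm
    have hg : ∀ t, i' < g t ∧ j' < π (g t) := by
      intro t
      have := (Reg π i j).orderEmbOfCardLe_mem hm t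
      change g t ∈ _ at this
      simp only [Reg, Finset.mem_filter, Finset.mem_univ, true_and] at this
      have n1 : g t ≠ i' := by
        intro h; rw [h] at this; omega
      have n2 : π (g t) ≠ j' := by
        intro h
        have : g t = π.symm j' := by rw [← h]; simp
        omega
      omega
    have hgm : ∀ s t, s < t → π (g s) < π (g t) := by
      intro s t hst
      have h1 : g s < g t := g.strictMono hst
      by_contra hh
      push Not at hh
      have hne : π (g t) ≠ π (g s) := by
        intro h
        have := π.injective h
        omega
      exact av132 hπ i' (g s) (g t) (hg s).1 h1 (by have := (hg t).2; omega)
        (lt_of_le_of_ne hh hne)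
    apply hav
    let f : Fin (m + 2) → Fin n := fun a =>
      if (a : ℕ) = 0 then π.symm j' else if h1 : (a : ℕ) = 1 then i'
        else if h2 : 2 ≤ (a : ℕ) then g ⟨a - 2, by omega⟩ else i'
    have f0 : ∀ a : Fin (m + 2), (a : ℕ) = 0 → f a = π.symm j' := by
      intro a h; simp only [f]; split_ifs <;> first | rfl | omega
    have f1 : ∀ a : Fin (m + 2), (a : ℕ) = 1 → f a = i' := by
      intro a h; simp only [f]; split_ifs <;> first | rfl | omega
    have f2 : ∀ a : Fin (m + 2), (h : 2 ≤ (a : ℕ)) → f a = g ⟨a - 2, by omega⟩ := by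
      intro a h
      have h0 : (a : ℕ) ≠ 0 := by omega
      have h1 : (a : ℕ) ≠ 1 := by omega
      simp only [f, h0, h1, h, if_false, dif_neg, dif_pos, not_false_eq_true]
    have hcase : ∀ a : Fin (m + 2), (a : ℕ) = 0 ∨ (a : ℕ) = 1 ∨ 2 ≤ (a : ℕ) := by
      intro a; omega
    have key : ∀ a b : Fin (m + 2), Equiv.swap (⟨0, by omega⟩ : Fin (m + 2)) ⟨1, by omega⟩ a <
        Equiv.swap (⟨0, by omega⟩ : Fin (m + 2)) ⟨1, by omega⟩ b → π (f a) < π (f b) := by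
      intro a b hab
      rw [Fin.lt_def, swap_val, swap_val] at hab
      rcases hcase a with ha | ha | ha <;> rcases hcase b with hb | hb | hb
      · simp [ha, hb] at hab
      · simp [ha, hb] at hab
      · rw [f0 a ha, f2 b hb]; simpa using (hg _).2
      · rw [f1 a ha, f0 b hb]; simp; omega
      · simp [ha, hb] at hab
      · rw [f1 a ha, f2 b hb]
        have := (hg ⟨b - 2, by omega⟩).2
        omega
      · split_ifs at hab <;> omega
      · split_ifs at hab <;> omega
      · rw [f2 a ha, f2 b hb]
        apply hgm
        rw [Fin.lt_def]
        simp only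
        split_ifs at hab <;> omega
    refine ⟨f, ?_, ?_⟩
    · intro a b hab
      rcases hcase a with ha | ha | ha <;> rcases hcase b with hb | hb | hb <;> try omega
      · rw [f0 a ha, f1 b hb]; omega
      · rw [f0 a ha, f2 b hb]
        have := (hg ⟨b - 2, by omega⟩).1
        omega
      · rw [f1 a ha, f2 b hb]; exact (hg _).1
      · rw [f2 a ha, f2 b hb]
        apply g.strictMono
        rw [Fin.lt_def]
        simp only
        omega
    · intro a b
      refine ⟨key a b, fun h => ?_⟩
      by_contra hh
      push Not at hh
      rcases hh.lt_or_eq with h' | h'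
      · exact absurd (key b a h') (not_lt.mpr h.le)
      · have := (Equiv.injective _) h'
        subst this
        exact lt_irrefl _ h
  · rintro hcor ⟨f, hf, hτ⟩
    have hm2 : 0 < m := by omega
    let z : Fin (m + 2) := ⟨0, by omega⟩
    let o : Fin (m + 2) := ⟨1, by omega⟩
    have h01 : f z < f o := hf _ _ (by simp [z, o])
    have h10 : π (f o) < π (f z) := (hτ o z).1 (by
      rw [Fin.lt_def, swap_val, swap_val]; simp [z, o])
    let S := (DiagramF π).filter (fun p => f z ≤ p.1 ∧ π (f o) ≤ p.2)
    have hS : S.Nonempty := ⟨(f z, π (f o)), by simp [S, DiagramF, h01, h10]⟩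
    obtain ⟨⟨i, j⟩, hpS, hmax⟩ := S.exists_max_image (fun p => (p.1 : ℕ) + p.2) hS
    simp only [S, Finset.mem_filter] at hpS hmax
    obtain ⟨hD, hzi, hoj⟩ := hpS
    have hr := diag_rows hπ hD
    have hcard := reg_card hπ hD
    have hc : (i, j) ∈ DCorners π := by
      simp only [DCorners, Finset.mem_filter]
      refine ⟨hD, ?_, ?_⟩
      · intro h hh
        have := hmax _ ⟨hh, by simp only [Fin.le_def] at *; omega, hoj⟩
        simp at this
      · intro h hh
        have := hmax _ ⟨hh, hzi, by simp only [Fin.le_def] at *; omega⟩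
        simp at this
    have hfin := hcor _ hc
    simp only at hfin
    have hio : i < f o := by
      by_contra hh
      have := hr (f o) (by omega)
      omega
    have hjz : j < π (f z) := hr _ hzi
    have hle : m ≤ (Reg π i j).card := by
      have hinj : Function.Injective (fun t : Fin m => f ⟨t + 2, by omega⟩) := by
        have hfm : StrictMono f := fun a b h => hf a b h
        intro s t hst
        have := hfm.injective hst
        simp only [Fin.mk.injEq] at this
        omega
      have := Finset.card_le_card_of_injOn (s := (Finset.univ : Finset (Fin m))) (t := Reg π i j)
        (fun t : Fin m => f ⟨t + 2, by omega⟩) ?_ hinj.injOn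
      · simpa using this
      · intro t _
        simp only [Reg, Finset.coe_filter, Finset.mem_univ, true_and, Set.mem_ofPred_eq]
        constructor
        · have := hf o ⟨t + 2, by omega⟩ (by simp [o, Fin.lt_def])
          omega
        · have := (hτ z ⟨t + 2, by omega⟩).1 (by
            rw [Fin.lt_def, swap_val, swap_val]; simp [z])
          omega
    omega
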